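/- arXiv:1210.2050 — 2 statements merged into one kernel-verified Lean document; each statement's English description precedes it below -/
import Mathlib

section
/- Let (𝒫, ℒ) be a linear space with dim(𝒫, ℒ) ≠ 2. Then for every point A ∈ 𝒫 the star of lines ℒ(A) is a maximal related set. -/
/-- A linear space: a point set `P` together with a set of lines (subsets of `P`),
each line having at least two points, and any two distinct points lying on
exactly one line. -/
structure LinearSpace (P : Type*) where
  lines : Set (Set P)
  two_points : ∀ l ∈ lines, ∃ A B : P, A ≠ B ∧ A ∈ l ∧ B ∈ l
  unique_line : ∀ A B : P, A ≠ B → ∃! l, l ∈ lines ∧ A ∈ l ∧ B ∈ l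

namespace LinearSpace

variable {P : Type*} (LS : LinearSpace P)

/-- A subspace: a subset containing, with any two of its distinct points,
the line joining them. -/
def IsSubspace (S : Set P) : Prop :=
  ∀ l ∈ LS.lines, ∀ A ∈ l, ∀ B ∈ l, A ≠ B → A ∈ S → B ∈ S → l ⊆ S

/-- The span of a subset: the intersection of all subspaces containing it. -/
def span (S : Set P) : Set P :=
  ⋂₀ {T | LS.IsSubspace T ∧ S ⊆ T}

/-- The dimension of a subset `S` (intended for subspaces):
`min {#X - 1 | X ⊆ S, span X = S}` as an extended natural number. -/
noncomputable def sdim (S : Set P) : ℕ∞ :=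
  sInf {d : ℕ∞ | ∃ X : Set P, X ⊆ S ∧ LS.span X = S ∧ d = X.encard - 1}

/-- The dimension of the linear space: `min {#X - 1 | span X = P}`. -/
noncomputable def dim : ℕ∞ := LS.sdim Set.univ

/-- A plane is a 2-dimensional subspace. -/
def IsPlane (E : Set P) : Prop := LS.IsSubspace E ∧ LS.sdim E = 2

/-- A generalized projective space: every plane is a generalized projective
plane, i.e. any two distinct lines contained in a common plane meet. -/
def IsGenProjSpace : Prop :=
  ∀ E : Set P, LS.IsPlane E →
    ∀ l ∈ LS.lines, ∀ m ∈ LS.lines, l ⊆ E → m ⊆ E → l ≠ m → (l ∩ m).Nonempty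

/-- A related set: a set of lines which pairwise meet. -/
def IsRelatedSet (N : Set (Set P)) : Prop :=
  N ⊆ LS.lines ∧ ∀ a ∈ N, ∀ b ∈ N, (a ∩ b).Nonempty

/-- A maximal related set: a related set maximal with respect to inclusion. -/
def IsMaxRelatedSet (M : Set (Set P)) : Prop :=
  LS.IsRelatedSet M ∧ ∀ N, LS.IsRelatedSet N → M ⊆ N → N = M

/-- The star of lines with vertex `A`: all lines through `A`. -/
def star (A : P) : Set (Set P) := {l | l ∈ LS.lines ∧ A ∈ l}

/-- The pencil of planes with axis `a`: all planes containing `a`. -/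
def pencil (a : Set P) : Set (Set P) := {E | LS.IsPlane E ∧ a ⊆ E}

/-- A collineation: a bijection of the point sets mapping each line onto a
line, and whose inverse does likewise. -/
def IsCollineation {P' : Type*} (LS' : LinearSpace P') (κ : P → P') : Prop :=
  Function.Bijective κ ∧ (∀ l ∈ LS.lines, κ '' l ∈ LS'.lines) ∧
    (∀ l' ∈ LS'.lines, κ ⁻¹' l' ∈ LS.lines)

end LinearSpace

namespace LinearSpace

variable {P : Type*} (LS : LinearSpace P)

theorem eq_of_mem {l m : Set P} (hl : l ∈ LS.lines) (hm : m ∈ LS.lines) {A B : P} (hAB : A ≠ B)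
    (hAl : A ∈ l) (hBl : B ∈ l) (hAm : A ∈ m) (hBm : B ∈ m) : l = m :=
  (LS.unique_line A B hAB).unique ⟨hl, hAl, hBl⟩ ⟨hm, hAm, hBm⟩

theorem isSubspace_of_subsingleton {S : Set P} (hS : S.Subsingleton) : LS.IsSubspace S :=
  fun _ _ _ _ _ _ hAB hA hB => absurd (hS hA hB) hAB

theorem isSubspace_of_mem_lines {l : Set P} (hl : l ∈ LS.lines) : LS.IsSubspace l := by
  intro m hm A hA B hB hAB hAl hBl
  rw [LS.eq_of_mem hm hl hAB hA hB hAl hBl]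

theorem eq_univ_of_span_eq_univ {X T : Set P} (hX : LS.span X = Set.univ) (hT : LS.IsSubspace T)
    (hXT : X ⊆ T) : T = Set.univ :=
  Set.univ_subset_iff.1 (hX ▸ Set.sInter_subset_of_mem ⟨hT, hXT⟩)

/-- In a linear space with a line missing some point, a spanning set has at least three points. -/
theorem three_le_encard_of_span_eq_univ {b : Set P} (hb : b ∈ LS.lines) {A : P} (hA : A ∉ b)
    {X : Set P} (hX : LS.span X = Set.univ) : 3 ≤ X.encard := by
  obtain ⟨B, C, hBC, hB, hC⟩ := LS.two_points b hb
  by_contra! h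
  have h2 : X.encard ≤ 2 := Order.le_of_lt_add_one h
  rcases X.subsingleton_or_nontrivial with hs | ⟨D, hD, E, hE, hDE⟩
  · have hu := LS.eq_univ_of_span_eq_univ hX (LS.isSubspace_of_subsingleton hs) subset_rfl
    exact hBC (hs (hu ▸ Set.mem_univ B) (hu ▸ Set.mem_univ C))
  · have hXDE : {D, E} = X :=
      (Set.toFinite {D, E}).eq_of_subset_of_encard_le (Set.pair_subset hD hE)
        (by rwa [Set.encard_pair hDE])
    obtain ⟨m, ⟨hm, hDm, hEm⟩, -⟩ := LS.unique_line D E hDE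
    have hu := LS.eq_univ_of_span_eq_univ hX (LS.isSubspace_of_mem_lines hm)
      (hXDE ▸ Set.pair_subset hDm hEm)
    have hbm := LS.eq_of_mem hb hm hBC hB hC (hu ▸ Set.mem_univ B) (hu ▸ Set.mem_univ C)
    exact hA (hbm.trans hu ▸ Set.mem_univ A)

/-- If every line through `A` meets the line `b`, then `A` and two points of `b` span. -/
theorem span_eq_univ_of_forall_inter_nonempty {b : Set P} (hb : b ∈ LS.lines) {A B C : P}
    (hA : A ∉ b) (hBC : B ≠ C) (hB : B ∈ b) (hC : C ∈ b)
    (h : ∀ l ∈ LS.lines, A ∈ l → (l ∩ b).Nonempty) : LS.span {A, B, C} = Set.univ := by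
  refine Set.eq_univ_of_forall fun Q T ⟨hT, hABC⟩ => ?_
  have hAT : A ∈ T := hABC (by simp)
  have hbT : b ⊆ T := hT b hb B hB C hC hBC (hABC (by simp)) (hABC (by simp))
  by_cases hAQ : A = Q
  · exact hAQ ▸ hAT
  obtain ⟨l, ⟨hl, hAl, hQl⟩, -⟩ := LS.unique_line A Q hAQ
  obtain ⟨Y, hYl, hYb⟩ := h l hl hAl
  exact hT l hl A hAl Y hYl (fun hAY => hA (hAY ▸ hYb)) hAT (hbT hYb) hQl

/-- A linear space is a plane if it has a line `b` and a point off `b` all of whose lines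
meet `b`. -/
theorem dim_eq_two_of_forall_inter_nonempty {b : Set P} (hb : b ∈ LS.lines) {A : P}
    (hA : A ∉ b) (h : ∀ l ∈ LS.lines, A ∈ l → (l ∩ b).Nonempty) : LS.dim = 2 := by
  obtain ⟨B, C, hBC, hB, hC⟩ := LS.two_points b hb
  have h31 : (3 : ℕ∞) - 1 = 2 := rfl
  apply le_antisymm
  · refine sInf_le ⟨{A, B, C}, Set.subset_univ _,
      LS.span_eq_univ_of_forall_inter_nonempty hb hA hBC hB hC h, ?_⟩
    have hAB : A ≠ B := fun hAB => hA (hAB ▸ hB)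
    have hAC : A ≠ C := fun hAC => hA (hAC ▸ hC)
    rw [Set.encard_eq_three.2 ⟨A, B, C, hAB, hAC, hBC, rfl⟩, h31]
  · refine le_sInf ?_
    rintro _ ⟨X, -, hX, rfl⟩
    rw [← h31]
    exact tsub_le_tsub_right (LS.three_le_encard_of_span_eq_univ hb hA hX) 1

theorem isRelatedSet_star (A : P) : LS.IsRelatedSet (LS.star A) :=
  ⟨fun _ hl => hl.1, fun _ ha _ hb => ⟨A, ha.2, hb.2⟩⟩

end LinearSpace

/-- If `dim (P, L) ≠ 2`, every star of lines is a maximal related set. -/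
theorem star_isMaxRelatedSet_of_dim_ne_two
    {P : Type*} (LS : LinearSpace P) (hdim : LS.dim ≠ 2) (A : P) :
    LS.IsMaxRelatedSet (LS.star A) := by
  refine ⟨LS.isRelatedSet_star A, fun N hN hAN => Set.Subset.antisymm (fun b hb => ?_) hAN⟩
  refine ⟨hN.1 hb, by_contra fun hA => hdim ?_⟩
  exact LS.dim_eq_two_of_forall_inter_nonempty (hN.1 hb) hA
    fun l hl hAl => hN.2 l (hAN ⟨hl, hAl⟩) b hb
end

section
/- Let (𝒫, ℒ) and (𝒫′, ℒ′) be linear spaces with dim(𝒫, ℒ) ≥ 3 and dim(𝒫′, ℒ′) ≥ 3, and let φ : ℒ → ℒ′ be a bijection such that a ∼ b if and only if φ(a) ∼′ φ(b) for all a, b ∈ ℒ. If there is a point A ∈ 𝒫 such that the image of the star ℒ(A) under φ is a star of lines ℒ′(A′) for some A′ ∈ 𝒫′, then for every point B ∈ 𝒫 the image of ℒ(B) under φ is a star of lines, and for every point B′ ∈ 𝒫′ the preimage of ℒ′(B′) under φ is a star of lines. -/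
namespace LinearSpace

variable {P P' : Type*} {LS : LinearSpace P} {LS' : LinearSpace P'}

theorem line_eq_of_mem {l m : Set P} (hl : l ∈ LS.lines) (hm : m ∈ LS.lines) {X Y : P}
    (hXY : X ≠ Y) (hXl : X ∈ l) (hYl : Y ∈ l) (hXm : X ∈ m) (hYm : Y ∈ m) : l = m :=
  (LS.unique_line X Y hXY).unique ⟨hl, hXl, hYl⟩ ⟨hm, hXm, hYm⟩

theorem exists_line (LS : LinearSpace P) {X Y : P} (hXY : X ≠ Y) :
    ∃ l ∈ LS.lines, X ∈ l ∧ Y ∈ l :=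
  (LS.unique_line X Y hXY).exists

theorem subset_span (S : Set P) : S ⊆ LS.span S :=
  Set.subset_sInter fun _ hT => hT.2

theorem isSubspace_span (S : Set P) : LS.IsSubspace (LS.span S) :=
  fun l hl X hX Y hY hXY hXS hYS =>
    Set.subset_sInter fun T hT => hT.1 l hl X hX Y hY hXY (hXS T hT) (hYS T hT)

/-- In a linear space of dimension at least `3`, no three points span the whole space. -/
theorem exists_notMem_span_triple (hdim : 3 ≤ LS.dim) (X Y Z : P) :
    ∃ Q, Q ∉ LS.span {X, Y, Z} := by
  by_contra! h
  have hle : LS.dim ≤ ({X, Y, Z} : Set P).encard - 1 :=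
    sInf_le ⟨_, Set.subset_univ _, Set.eq_univ_of_forall h, rfl⟩
  have hcard : ({X, Y, Z} : Set P).encard ≤ 3 := by
    calc ({X, Y, Z} : Set P).encard ≤ (({Z} : Set P).encard + 1) + 1 :=
          (Set.encard_insert_le _ _).trans (by gcongr; exact Set.encard_insert_le _ _)
      _ = 3 := by rw [Set.encard_singleton]; norm_num
  have h32 : (3 : ℕ∞) ≤ 3 - 1 := (hdim.trans hle).trans (tsub_le_tsub_right hcard 1)
  exact absurd h32 (by decide)

/-- In a linear space of dimension at least `3`, a star determines its vertex. -/
theorem eq_of_star_subset_star (hdim : 3 ≤ LS.dim) {B C : P} (h : LS.star B ⊆ LS.star C) :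
    B = C := by
  by_contra hBC
  obtain ⟨Q, hQ⟩ := exists_notMem_span_triple hdim B C C
  have hBS : B ∈ LS.span {B, C, C} := subset_span _ (by simp)
  have hCS : C ∈ LS.span {B, C, C} := subset_span _ (by simp)
  obtain ⟨l, hl, hBl, hQl⟩ := LS.exists_line (ne_of_mem_of_not_mem hBS hQ)
  exact hQ (isSubspace_span _ l hl B hBl C (h ⟨hl, hBl⟩).2 hBC hBS hCS hQl)

/-- A relatedness-preserving bijection of lines that maps one star onto a star maps every star
into a star. -/
theorem exists_image_star_subset (hdim : 3 ≤ LS.dim)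
    {φ : Set P → Set P'} (hbij : Set.BijOn φ LS.lines LS'.lines)
    (hrel : ∀ a ∈ LS.lines, ∀ b ∈ LS.lines, ((a ∩ b).Nonempty ↔ (φ a ∩ φ b).Nonempty))
    {A : P} {A' : P'} (hA : φ '' LS.star A = LS'.star A') (B : P) :
    ∃ B' : P', φ '' LS.star B ⊆ LS'.star B' := by
  rcases eq_or_ne A B with rfl | hAB
  · exact ⟨A', hA.subset⟩
  have not_mem : ∀ f ∈ LS.lines, A ∉ f → A' ∉ φ f := by
    intro f hf hAf hA'
    obtain ⟨k, hk, hkf⟩ := hA.superset ⟨hbij.mapsTo hf, hA'⟩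
    exact hAf (hbij.injOn hk.1 hf hkf ▸ hk.2)
  have exists_preimage : ∀ W : P', W ≠ A' → ∃ k ∈ LS.lines, A ∈ k ∧ W ∈ φ k := by
    intro W hW
    obtain ⟨k', hk', hWk, hAk⟩ := LS'.exists_line hW
    obtain ⟨k, hk, rfl⟩ := hA.superset ⟨hk', hAk⟩
    exact ⟨k, hk.1, hk.2, hWk⟩
  obtain ⟨c, hc, hAc, hBc⟩ := LS.exists_line hAB
  have eq_c : ∀ k ∈ LS.lines, A ∈ k → B ∈ k → k = c := fun k hk h1 h2 =>
    line_eq_of_mem hk hc hAB h1 h2 hAc hBc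
  obtain ⟨b, hb, hBb, hAb⟩ : ∃ b ∈ LS.lines, B ∈ b ∧ A ∉ b := by
    by_contra! h
    exact hAB (eq_of_star_subset_star hdim fun l hl => ⟨hl.1, h l hl.1 hl.2⟩).symm
  have ne_image : ∀ f ∈ LS.lines, A ∉ f → φ f ≠ φ c := fun f hf hAf h =>
    hAf (hbij.injOn hf hc h ▸ hAc)
  obtain ⟨X, hXb, hXc⟩ := (hrel b hb c hc).1 ⟨B, hBb, hBc⟩
  refine ⟨X, ?_⟩
  rintro _ ⟨d, ⟨hd, hBd⟩, rfl⟩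
  refine ⟨hbij.mapsTo hd, ?_⟩
  by_cases hAd : A ∈ d
  · rwa [eq_c d hd hAd hBd]
  obtain ⟨Y, hYd, hYc⟩ := (hrel d hd c hc).1 ⟨B, hBd, hBc⟩
  by_contra hXd
  have hXY : X ≠ Y := fun h => hXd (h ▸ hYd)
  obtain ⟨Z, hZb, hZd⟩ := (hrel b hb d hd).1 ⟨B, hBb, hBd⟩
  have hZc : Z ∉ φ c := fun hZc => ne_image b hb hAb <|
    line_eq_of_mem (hbij.mapsTo hb) (hbij.mapsTo hc) (ne_of_mem_of_not_mem hZd hXd).symm hXb hZb hXc hZc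
  obtain ⟨e, he, hAe, hZe⟩ :=
    exists_preimage Z fun h => not_mem b hb hAb (h ▸ hZb)
  have hBe : B ∉ e := fun h => hZc (eq_c e he hAe h ▸ hZe)
  obtain ⟨B₁, hB₁b, hB₁e⟩ := (hrel b hb e he).2 ⟨Z, hZb, hZe⟩
  obtain ⟨B₂, hB₂d, hB₂e⟩ := (hrel d hd e he).2 ⟨Z, hZd, hZe⟩
  obtain ⟨Q, hQ⟩ := exists_notMem_span_triple hdim A B B₁
  set S := LS.span {A, B, B₁}
  have hsub : LS.IsSubspace S := isSubspace_span _
  have hAS : A ∈ S := subset_span _ (by simp)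
  have hBS : B ∈ S := subset_span _ (by simp)
  have hB₁S : B₁ ∈ S := subset_span _ (by simp)
  have hbS : b ⊆ S := hsub b hb B hBb B₁ hB₁b (fun h => hBe (h ▸ hB₁e)) hBS hB₁S
  have heS : e ⊆ S := hsub e he A hAe B₁ hB₁e (fun h => hAb (h ▸ hB₁b)) hAS hB₁S
  have hdS : d ⊆ S :=
    hsub d hd B hBd B₂ hB₂d (fun h => hBe (h ▸ hB₂e)) hBS (heS hB₂e)
  obtain ⟨g, hg, hBg, hQg⟩ := LS.exists_line (ne_of_mem_of_not_mem hBS hQ)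
  have hAg : A ∉ g := fun h => hQ (hsub g hg A h B hBg hAB hAS hBS hQg)
  -- The images of `g` and of a line through `B` in `S` can only meet on `φ c`.
  have meet_on_c : ∀ f ∈ LS.lines, A ∉ f → f ⊆ S → ∀ W ∈ φ f, W ∈ φ g → W ∈ φ c := by
    intro f hf hAf hfS W hWf hWg
    obtain ⟨k, hk, hAk, hWk⟩ :=
      exists_preimage W fun h => not_mem f hf hAf (h ▸ hWf)
    obtain ⟨F, hFf, hFk⟩ := (hrel f hf k hk).2 ⟨W, hWf, hWk⟩
    obtain ⟨G, hGg, hGk⟩ := (hrel g hg k hk).2 ⟨W, hWg, hWk⟩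
    have hkS : k ⊆ S := hsub k hk A hAk F hFk (fun h => hAf (h ▸ hFf)) hAS (hfS hFf)
    have hBG : B = G := by
      by_contra hBG
      exact hQ (hsub g hg B hBg G hGg hBG hBS (hkS hGk) hQg)
    rwa [← eq_c k hk hAk (hBG ▸ hGk)]
  have mem_g : ∀ f ∈ LS.lines, B ∈ f → A ∉ f → f ⊆ S → ∀ T ∈ φ f, T ∈ φ c → T ∈ φ g := by
    intro f hf hBf hAf hfS T hTf hTc
    obtain ⟨W, hWf, hWg⟩ := (hrel f hf g hg).1 ⟨B, hBf, hBg⟩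
    have hWc := meet_on_c f hf hAf hfS W hWf hWg
    by_contra hTg
    exact ne_image f hf hAf <| line_eq_of_mem (hbij.mapsTo hf) (hbij.mapsTo hc)
      (ne_of_mem_of_not_mem hWg hTg).symm hTf hWf hTc hWc
  exact ne_image g hg hAg <| line_eq_of_mem (hbij.mapsTo hg) (hbij.mapsTo hc) hXY
    (mem_g b hb hBb hAb hbS X hXb hXc) (mem_g d hd hBd hAd hdS Y hYd hYc) hXc hYc

end LinearSpace

/-- If a relatedness-preserving line bijection `φ` (both directions, dimensions
at least 3) maps one star of lines onto a star of lines, then it maps every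
star onto a star, and the preimage of every star is a star. -/
theorem star_to_star_of_one_star
    {P P' : Type*} (LS : LinearSpace P) (LS' : LinearSpace P')
    (hdim : 3 ≤ LS.dim) (hdim' : 3 ≤ LS'.dim)
    (φ : Set P → Set P') (hbij : Set.BijOn φ LS.lines LS'.lines)
    (hrel : ∀ a ∈ LS.lines, ∀ b ∈ LS.lines,
      ((a ∩ b).Nonempty ↔ (φ a ∩ φ b).Nonempty))
    (A : P) (A' : P') (hA : φ '' LS.star A = LS'.star A') :
    (∀ B : P, ∃ B' : P', φ '' LS.star B = LS'.star B') ∧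
    (∀ B' : P', ∃ B : P, {a | a ∈ LS.lines ∧ φ a ∈ LS'.star B'} = LS.star B) := by
  have hinv := hbij.invOn_invFunOn
  set ψ := Function.invFunOn φ LS.lines
  have hψ : Set.BijOn ψ LS'.lines LS.lines :=
    hinv.symm.bijOn hbij.surjOn.mapsTo_invFunOn hbij.mapsTo
  have hψrel : ∀ a ∈ LS'.lines, ∀ b ∈ LS'.lines,
      ((a ∩ b).Nonempty ↔ (ψ a ∩ ψ b).Nonempty) := fun a ha b hb => by
    rw [hrel _ (hψ.mapsTo ha) _ (hψ.mapsTo hb), hinv.2 ha, hinv.2 hb]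
  have hψA : ψ '' LS'.star A' = LS.star A := by
    rw [← hA, (hinv.1.mono fun _ h => h.1).image_image]
  have hφstar := LinearSpace.exists_image_star_subset hdim hbij hrel hA
  have hψstar := LinearSpace.exists_image_star_subset hdim' hψ hψrel hψA
  refine ⟨fun B => ?_, fun B' => ?_⟩
  · obtain ⟨B', hB'⟩ := hφstar B
    obtain ⟨C, hC⟩ := hψstar B'
    obtain rfl : B = C := LinearSpace.eq_of_star_subset_star hdim fun l hl =>
      hC ⟨φ l, hB' ⟨l, hl, rfl⟩, hinv.1 hl.1⟩
    exact ⟨B', hB'.antisymm fun l hl => ⟨ψ l, hC ⟨l, hl, rfl⟩, hinv.2 hl.1⟩⟩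
  · obtain ⟨B, hB⟩ := hψstar B'
    obtain ⟨C', hC'⟩ := hφstar B
    obtain rfl : B' = C' := LinearSpace.eq_of_star_subset_star hdim' fun l hl =>
      hC' ⟨ψ l, hB ⟨l, hl, rfl⟩, hinv.2 hl.1⟩
    refine ⟨B, Set.Subset.antisymm (fun a ha => ?_) fun a ha => ⟨ha.1, hC' ⟨a, ha, rfl⟩⟩⟩
    exact hB ⟨φ a, ha.2, hinv.1 ha.1⟩
end
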